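/- arXiv:1805.04796 — 2 statements merged into one kernel-verified Lean document; each statement's English description precedes it below -/
import Mathlib

section
/- For every continuous function f : S^n → ℝ^k with k ≤ n, there exists a point x in S^n such that f(-x) = f(x). -/
open MvPolynomial

/-- A commutative real algebra acting on a space of odd finite dimension has a real point. -/
theorem nonempty_algHom_real_of_odd_finrank {A : Type*} [CommRing A] [Algebra ℝ A] (V : Type*)
    [AddCommGroup V] [Module ℝ V] [Module A V] [IsScalarTower ℝ A V]
    (hV : Odd (Module.finrank ℝ V)) : Nonempty (A →ₐ[ℝ] ℝ) := by
  induction hm : Module.finrank ℝ V using Nat.strong_induction_on generalizing V with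
  | _ m ih =>
    have : FiniteDimensional ℝ V := Module.finite_of_finrank_pos hV.pos
    have : Nontrivial V := Module.nontrivial_of_finrank_pos hV.pos
    by_cases hs : IsSimpleModule A V
    · obtain ⟨I, hI, ⟨e⟩⟩ := isSimpleModule_iff_quot_maximal.1 hs
      let _ : Field (A ⧸ I) := Ideal.Quotient.field I
      let e' : V ≃ₗ[ℝ] (A ⧸ I) := e.restrictScalars ℝ
      have : FiniteDimensional ℝ (A ⧸ I) := e'.finiteDimensional
      rw [e'.finrank_eq] at hV
      rcases Real.nonempty_algEquiv_or (A ⧸ I) with ⟨⟨g⟩⟩ | ⟨⟨g⟩⟩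
      · exact ⟨g.toAlgHom.comp (Ideal.Quotient.mkₐ ℝ I)⟩
      · rw [g.toLinearEquiv.finrank_eq, Complex.finrank_real_complex] at hV
        exact absurd hV (by decide)
    · obtain ⟨W, hbot, htop⟩ : ∃ W : Submodule A V, W ≠ ⊥ ∧ W ≠ ⊤ := by
        by_contra! h
        exact hs ((isSimpleModule_iff A V).2
          { eq_bot_or_eq_top := fun W => or_iff_not_imp_left.2 (h W) })
      have hadd := (W.restrictScalars ℝ).finrank_quotient_add_finrank
      have hW : 0 < Module.finrank ℝ W := by
        have := Submodule.nontrivial_iff_ne_bot.2 hbot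
        have : Module.Finite ℝ W :=
          FiniteDimensional.finiteDimensional_submodule (W.restrictScalars ℝ)
        exact Module.finrank_pos
      have hQ : 0 < Module.finrank ℝ (V ⧸ W) := by
        have : Nontrivial (V ⧸ W.restrictScalars ℝ) := Submodule.Quotient.nontrivial_iff.2
          (mt (Submodule.restrictScalars_eq_top_iff ℝ A V).1 htop)
        exact Module.finrank_pos (R := ℝ) (M := V ⧸ W.restrictScalars ℝ)
      change Module.finrank ℝ (V ⧸ W) + Module.finrank ℝ W = _ at hadd
      rw [← hadd, Nat.odd_add] at hV
      rcases Nat.even_or_odd (Module.finrank ℝ W) with h | h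
      · exact ih _ (by omega) (V ⧸ W) (hV.2 h) rfl
      · exact ih _ (by omega) W h rfl


namespace MvPolynomial

variable {σ R S : Type*} [Fintype σ] [CommRing R] [CommRing S]

/-- The linear endomorphism of `R[X]` sending `∏ Xᵢ ^ (rᵢ + d * bᵢ)`, where `rᵢ < d`, to
`∏ Xᵢ ^ rᵢ * qᵢ ^ bᵢ`. -/
noncomputable def substPow (d : ℕ) (q : σ → MvPolynomial σ R) :
    MvPolynomial σ R →ₗ[R] MvPolynomial σ R :=
  (basisMonomials σ R).constr R fun b => ∏ i, X i ^ (b i % d) * q i ^ (b i / d)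

theorem substPow_monomial (d : ℕ) (q : σ → MvPolynomial σ R) (b : σ →₀ ℕ) (r : R) :
    substPow d q (monomial b r) = r • ∏ i, X i ^ (b i % d) * q i ^ (b i / d) := by
  have := (basisMonomials σ R).constr_basis R (fun b => ∏ i, X i ^ (b i % d) * q i ^ (b i / d)) b
  rw [coe_basisMonomials] at this
  rw [← mul_one r, ← smul_eq_mul, ← smul_monomial, map_smul, substPow, this, smul_eq_mul, mul_one]

theorem substPow_X_pow_mul {d : ℕ} (hd : 0 < d) (q : σ → MvPolynomial σ R) (i : σ)
    (p : MvPolynomial σ R) : substPow d q (X i ^ d * p) = q i * substPow d q p := by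
  classical
  induction p using MvPolynomial.induction_on' with
  | add p₁ p₂ h₁ h₂ => simp only [mul_add, map_add, h₁, h₂]
  | monomial b r =>
    rw [X_pow_eq_monomial, monomial_mul, one_mul, substPow_monomial, substPow_monomial,
      mul_smul_comm]
    congr 1
    rw [← Finset.mul_prod_erase _ _ (Finset.mem_univ i),
      ← Finset.mul_prod_erase Finset.univ (fun j => X j ^ (b j % d) * q j ^ (b j / d))
        (Finset.mem_univ i)]
    have : ∀ j ∈ Finset.univ.erase i, (Finsupp.single i d + b) j = b j := by
      intro j hj
      simp [(Finset.ne_of_mem_erase hj).symm]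
    rw [Finset.prod_congr rfl fun j hj => by rw [this j hj]]
    simp only [Finsupp.add_apply, Finsupp.single_eq_same, Nat.add_mod_left, Nat.add_div_left _ hd]
    ring

theorem totalDegree_substPow_le {d : ℕ} {q : σ → MvPolynomial σ R}
    (hq : ∀ i, (q i).totalDegree ≤ d) (p : MvPolynomial σ R) :
    (substPow d q p).totalDegree ≤ p.totalDegree := by
  conv_lhs => rw [p.as_sum, map_sum]
  refine totalDegree_finsetSum_le fun b hb => ?_
  rw [substPow_monomial]
  refine (totalDegree_smul_le _ _).trans (le_trans ?_ (le_totalDegree hb))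
  rw [Finsupp.sum_fintype _ _ fun _ => rfl]
  refine (totalDegree_finsetProd _ _).trans (Finset.sum_le_sum fun i _ => ?_)
  calc _ ≤ (X i ^ (b i % d) : MvPolynomial σ R).totalDegree + (q i ^ (b i / d)).totalDegree :=
        totalDegree_mul _ _
    _ ≤ b i % d + b i / d * d := by
        refine add_le_add ?_ ((totalDegree_pow _ _).trans (Nat.mul_le_mul_left _ (hq i)))
        rw [X_pow_eq_monomial]
        exact (totalDegree_monomial_le _ _).trans (by simp)
    _ = b i := by rw [mul_comm, Nat.mod_add_div]

theorem map_substPow_monomial (φ : R →+* S) (d : ℕ) (q : σ → MvPolynomial σ R) (b : σ →₀ ℕ) :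
    map φ (substPow d q (monomial b 1)) = substPow d (fun i => map φ (q i)) (monomial b 1) := by
  simp [substPow_monomial, map_prod]

theorem substPow_X_pow (d : ℕ) (p : MvPolynomial σ R) : substPow d (fun i => X i ^ d) p = p := by
  induction p using MvPolynomial.induction_on' with
  | add p₁ p₂ h₁ h₂ => simp only [map_add, h₁, h₂]
  | monomial b r =>
    rw [substPow_monomial, monomial_eq, Finsupp.prod_fintype _ _ fun _ => pow_zero _, smul_eq_C_mul]
    simp only [← pow_mul, ← pow_add, Nat.mod_add_div]

theorem injective_of_det_coeff_ne_zero [IsDomain R]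
    (φ : MvPolynomial σ R →ₗ[R] MvPolynomial σ R)
    (h : ∀ s : Finset (σ →₀ ℕ), (Matrix.of fun a b : s => coeff a.1 (φ (monomial b.1 1))).det ≠ 0) :
    Function.Injective φ := by
  refine (injective_iff_map_eq_zero φ).2 fun p hp => ?_
  have hv : (fun b : p.support => coeff b.1 p) = 0 := by
    refine Matrix.eq_zero_of_mulVec_eq_zero (h p.support) ?_
    funext a
    have hsum : φ p = ∑ b : p.support, coeff b.1 p • φ (monomial b.1 1) := by
      conv_lhs => rw [p.as_sum, map_sum, ← Finset.sum_coe_sort]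
      exact Finset.sum_congr rfl fun b _ => by
        rw [← map_smul, smul_monomial, smul_eq_mul, mul_one]
    have ha := congrArg (coeff a.1) (hsum.symm.trans hp)
    simpa [coeff_sum, Matrix.mulVec, dotProduct, mul_comm] using ha
  ext b
  by_cases hb : b ∈ p.support
  · exact congrFun hv ⟨b, hb⟩
  · exact notMem_support_iff.1 hb

theorem substPow_bijective_of_injective {K : Type*} [Field K] {d : ℕ} {q : σ → MvPolynomial σ K}
    (hq : ∀ i, (q i).totalDegree ≤ d) (h : Function.Injective (substPow d q)) :
    Function.Bijective (substPow d q) := by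
  refine ⟨h, fun p => ?_⟩
  have hle : ∀ r ∈ restrictTotalDegree σ K p.totalDegree,
      substPow d q r ∈ restrictTotalDegree σ K p.totalDegree := fun r hr => by
    rw [mem_restrictTotalDegree] at hr ⊢
    exact (totalDegree_substPow_le hq r).trans hr
  have : Finite {f : σ →₀ ℕ | (f.sum fun _ e => e) ≤ p.totalDegree} :=
    (Finsupp.finite_of_degree_le (σ := σ) p.totalDegree).to_subtype
  have : Module.Finite K (restrictTotalDegree σ K p.totalDegree) :=
    .of_basis (basisRestrictSupport K {f : σ →₀ ℕ | (f.sum fun _ e => e) ≤ p.totalDegree})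
  have hinj : Function.Injective ((substPow d q).restrict hle) :=
    fun x y hxy => Subtype.ext (h (congrArg Subtype.val hxy))
  obtain ⟨y, hy⟩ := LinearMap.surjective_of_injective hinj
    ⟨p, (mem_restrictTotalDegree _ _ _).2 le_rfl⟩
  exact ⟨y, congrArg Subtype.val hy⟩

theorem exists_countable_substPow_injective {K : Type*} [Field K] (d : ℕ)
    (p : σ → MvPolynomial σ K) : ∃ B : Set K, B.Countable ∧ ∀ t ∉ B,
      Function.Injective (substPow d fun i => X i ^ d + C t * p i) := by
  let Q : σ → MvPolynomial σ (Polynomial K) :=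
    fun i => X i ^ d + C Polynomial.X * map Polynomial.C (p i)
  let D : Finset (σ →₀ ℕ) → Polynomial K := fun s =>
    (Matrix.of fun a b : s => coeff a.1 (substPow d Q (monomial b.1 1))).det
  have hD : ∀ s t, (D s).eval t = (Matrix.of fun a b : s =>
      coeff a.1 (substPow d (fun i => X i ^ d + C t * p i) (monomial b.1 1))).det := by
    intro s t
    have hQ : (fun i => X i ^ d + C t * p i) = fun i => map (Polynomial.evalRingHom t) (Q i) := by
      funext i
      have : (Polynomial.evalRingHom t).comp Polynomial.C = RingHom.id K := by ext; simp
      simp only [Q, map_add, map_pow, map_X, map_mul, map_C, map_map, this, MvPolynomial.map_id,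
        Polynomial.coe_evalRingHom, Polynomial.eval_X]
    rw [← Polynomial.coe_evalRingHom, RingHom.map_det, hQ]
    congr 1
    ext a b
    simp [← map_substPow_monomial, coeff_map]
  have hD0 : ∀ s, D s ≠ 0 := by
    intro s hs
    have h := hD s 0
    simp only [C_0, zero_mul, add_zero, substPow_X_pow, hs, Polynomial.eval_zero] at h
    have h1 : (Matrix.of fun a b : s => coeff a.1 (monomial b.1 (1 : K))) = 1 := by
      classical
      ext a b
      simp only [Matrix.of_apply, coeff_monomial, Matrix.one_apply, Subtype.ext_iff, eq_comm (a := b.1)]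
    rw [h1, Matrix.det_one] at h
    exact zero_ne_one h
  refine ⟨⋃ s, (D s).rootSet K,
    Set.countable_iUnion fun s => (Polynomial.rootSet_finite _ _).countable,
    fun t ht => injective_of_det_coeff_ne_zero _ fun s => ?_⟩
  rw [← hD]
  intro h
  exact ht (Set.mem_iUnion.2 ⟨s, (Polynomial.mem_rootSet_of_ne (hD0 s)).2 (by simpa using h)⟩)

theorem finrank_quotient_span_of_substPow_bijective {K : Type*} [Field K] {d : ℕ} (hd : 0 < d)
    {q : σ → MvPolynomial σ K} (h : Function.Bijective (substPow d q)) :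
    Module.finrank K (MvPolynomial σ K ⧸ Ideal.span (Set.range q)) = d ^ Fintype.card σ := by
  classical
  let e : MvPolynomial σ K ≃ₗ[K] MvPolynomial σ K := .ofBijective _ h
  let π : MvPolynomial σ K →ₗ[K] ((σ → Fin d) → K) :=
    LinearMap.pi fun a => lcoeff K (Finsupp.equivFunOnFinite.symm fun i => (a i : ℕ))
  have hπ : ∀ p a, π p a = coeff (Finsupp.equivFunOnFinite.symm fun i => (a i : ℕ)) p :=
    fun _ _ => rfl
  have hsurj : Function.Surjective π := by
    intro v
    refine ⟨∑ a, monomial (Finsupp.equivFunOnFinite.symm fun i => (a i : ℕ)) (v a), ?_⟩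
    funext b
    rw [hπ, coeff_sum, Finset.sum_eq_single b]
    · simp
    · intro a _ hab
      rw [coeff_monomial, if_neg]
      intro hc
      exact hab (_root_.funext fun i => Fin.ext (congrFun (Finsupp.equivFunOnFinite.symm.injective hc) i))
    · simp
  have hker : LinearMap.ker (π ∘ₗ e.symm.toLinearMap) =
      (Ideal.span (Set.range q)).restrictScalars K := by
    apply le_antisymm
    · intro p hp
      obtain ⟨r, rfl⟩ := e.surjective p
      have hr : π r = 0 := by simpa using hp
      change substPow d q r ∈ Ideal.span (Set.range q)
      rw [r.as_sum, map_sum]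
      refine Ideal.sum_mem _ fun b hb => ?_
      obtain ⟨i, hi⟩ : ∃ i, d ≤ b i := by
        by_contra! hlt
        refine mem_support_iff.1 hb ?_
        have := congrFun hr fun i => ⟨b i, hlt i⟩
        rwa [hπ, show (Finsupp.equivFunOnFinite.symm fun i => b i) = b from
          Finsupp.equivFunOnFinite.symm_apply_apply b] at this
      have hb' : monomial b (coeff b r) =
          X i ^ d * monomial (b - Finsupp.single i d) (coeff b r) := by
        rw [X_pow_eq_monomial, monomial_mul, one_mul, add_tsub_cancel_of_le]
        simpa using hi
      rw [hb', substPow_X_pow_mul hd]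
      exact Ideal.mul_mem_right _ _ (Ideal.subset_span ⟨i, rfl⟩)
    · intro p hp
      obtain ⟨c, rfl⟩ := Ideal.mem_span_range_iff_exists_fun.1 hp
      refine sum_mem fun i _ => ?_
      obtain ⟨r, hr⟩ := e.surjective (c i)
      have hmul : c i * q i = e (X i ^ d * r) := by
        rw [← hr, mul_comm]
        exact (substPow_X_pow_mul hd q i r).symm
      rw [hmul, LinearMap.mem_ker, LinearMap.comp_apply, LinearEquiv.coe_coe,
        LinearEquiv.symm_apply_apply]
      funext a
      rw [hπ, X_pow_eq_monomial, coeff_monomial_mul', if_neg]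
      · rfl
      · intro hle
        have := hle i
        simp only [Finsupp.single_eq_same, Finsupp.equivFunOnFinite_symm_apply_apply] at this
        exact absurd (a i).2 (not_lt.2 this)
  have E := LinearMap.quotKerEquivOfSurjective (π ∘ₗ e.symm.toLinearMap)
    (hsurj.comp e.symm.surjective)
  rw [hker] at E
  refine E.finrank_eq.trans ?_
  simp

/-- For arbitrarily large `t`, the system `xᵢ ^ d + t * pᵢ(x) = 0` of odd degree `d` has a real
solution: the algebra it defines has odd dimension. -/
theorem exists_pow_add_mul_eval_eq_zero {σ : Type*} [Fintype σ] {d : ℕ} (hd : Odd d)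
    {p : σ → MvPolynomial σ ℝ} (hp : ∀ i, (p i).totalDegree ≤ d) (M : ℝ) :
    ∃ t > M, ∃ c : σ → ℝ, ∀ i, c i ^ d + t * eval c (p i) = 0 := by
  obtain ⟨B, hB, hinj⟩ := exists_countable_substPow_injective d p
  obtain ⟨t, ht, htM⟩ := (hB.dense_compl ℝ).exists_gt M
  have hq : ∀ i, (X i ^ d + C t * p i).totalDegree ≤ d := fun i => by
    refine (totalDegree_add _ _).trans (max_le (totalDegree_X_pow i d).le ?_)
    rw [← smul_eq_C_mul]
    exact (totalDegree_smul_le _ _).trans (hp i)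
  have hfin := finrank_quotient_span_of_substPow_bijective hd.pos
    (substPow_bijective_of_injective hq (hinj t ht))
  set I := Ideal.span (Set.range fun i => X i ^ d + C t * p i)
  obtain ⟨φ⟩ := nonempty_algHom_real_of_odd_finrank (A := MvPolynomial σ ℝ ⧸ I)
    (MvPolynomial σ ℝ ⧸ I) (hfin ▸ hd.pow)
  let ψ : MvPolynomial σ ℝ →ₐ[ℝ] ℝ := φ.comp (Ideal.Quotient.mkₐ ℝ I)
  have hψ : ∀ r, ψ r = eval (fun i => ψ (X i)) r := fun r => by
    conv_lhs => rw [← aeval_X_left_apply (R := ℝ) r, comp_aeval_apply]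
    rw [← coe_aeval_eq_eval]
    rfl
  refine ⟨t, htM, fun i => ψ (X i), fun i => ?_⟩
  have h0 : ψ (X i ^ d + C t * p i) = 0 := by
    have : Ideal.Quotient.mkₐ ℝ I (X i ^ d + C t * p i) = 0 :=
      Ideal.Quotient.eq_zero_iff_mem.2 (Ideal.subset_span ⟨i, rfl⟩)
    rw [AlgHom.comp_apply, this, map_zero]
  rw [hψ] at h0
  simpa using h0

/-- On the affine chart `x₀ = 1` of the sphere, the odd part of a polynomial is a polynomial of
degree at most `d` divided by the `d`-th power of the norm, for every large odd `d`. -/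
theorem exists_eval_eq_norm_pow_mul_sub {n : ℕ} (P : MvPolynomial (Fin (n + 1)) ℝ) :
    ∃ N : ℕ, ∀ d, Odd d → N ≤ d → ∃ p : MvPolynomial (Fin n) ℝ, p.totalDegree ≤ d ∧
      ∀ (c : Fin n → ℝ) (r : ℝ), 0 < r → r ^ 2 = 1 + ∑ i, c i ^ 2 →
        2 * eval c p = r ^ d * (eval (r⁻¹ • (Fin.cons 1 c : Fin (n + 1) → ℝ)) P -
          eval (-(r⁻¹ • (Fin.cons 1 c : Fin (n + 1) → ℝ))) P) := by
  induction P using MvPolynomial.induction_on' with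
  | add P₁ P₂ h₁ h₂ =>
    obtain ⟨N₁, h₁⟩ := h₁
    obtain ⟨N₂, h₂⟩ := h₂
    refine ⟨max N₁ N₂, fun d hd hN => ?_⟩
    obtain ⟨p₁, hd₁, hp₁⟩ := h₁ d hd (le_of_max_le_left hN)
    obtain ⟨p₂, hd₂, hp₂⟩ := h₂ d hd (le_of_max_le_right hN)
    refine ⟨p₁ + p₂, (totalDegree_add _ _).trans (max_le hd₁ hd₂), fun c r hr hrc => ?_⟩
    simp only [map_add, mul_add, hp₁ c r hr hrc, hp₂ c r hr hrc]
    ring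
  | monomial b a =>
    have heval : ∀ (s : ℝ) (x : Fin (n + 1) → ℝ), eval (s • x) (monomial b a) =
        a * (s ^ (∑ j, b j) * ∏ j, x j ^ b j) := fun s x => by
      rw [eval_monomial, Finsupp.prod_fintype _ _ fun _ => pow_zero _, ← Finset.prod_pow_eq_pow_sum,
        ← Finset.prod_mul_distrib]
      simp only [Pi.smul_apply, smul_eq_mul, mul_pow]
    refine ⟨∑ j, b j, fun d hd hN => ?_⟩
    rcases Nat.even_or_odd (∑ j, b j) with he | ho
    · refine ⟨0, by simp, fun c r _ _ => ?_⟩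
      rw [← neg_smul, heval, heval, he.neg_pow]
      simp
    · obtain ⟨m, hm⟩ := Nat.Odd.sub_odd hd ho
      refine ⟨C a * ((1 + ∑ i, X i ^ 2) ^ m * ∏ i, X i ^ b (Fin.succ i)), ?_, fun c r hr hrc => ?_⟩
      · rw [← smul_eq_C_mul]
        refine (totalDegree_smul_le _ _).trans ((totalDegree_mul _ _).trans ?_)
        have h1 : ((1 + ∑ i : Fin n, X i ^ 2 : MvPolynomial (Fin n) ℝ) ^ m).totalDegree ≤ m * 2 := by
          refine (totalDegree_pow _ _).trans (Nat.mul_le_mul_left _ ?_)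
          refine (totalDegree_add _ _).trans (max_le (by simp) ?_)
          exact totalDegree_finsetSum_le fun i _ => (totalDegree_X_pow i 2).le
        have h2 : (∏ i : Fin n, X i ^ b (Fin.succ i) : MvPolynomial (Fin n) ℝ).totalDegree ≤
            ∑ i : Fin n, b i.succ :=
          (totalDegree_finsetProd _ _).trans
            (Finset.sum_le_sum fun i _ => (totalDegree_X_pow _ _).le)
        rw [Fin.sum_univ_succ] at hm hN
        omega
      · have hd' : d = (∑ j, b j) + 2 * m := by omega
        rw [← neg_smul, heval, heval, ho.neg_pow, Fin.prod_univ_succ]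
        simp only [map_mul, eval_C, map_pow, map_add, map_one, map_sum, eval_X, map_prod,
          Fin.cons_zero, Fin.cons_succ, one_pow, one_mul, ← hrc]
        have hr' : r ^ d * r⁻¹ ^ (∑ j, b j) = (r ^ 2) ^ m := by
          rw [hd', pow_add, mul_right_comm, ← mul_pow, mul_inv_cancel₀ hr.ne', one_pow, one_mul,
            pow_mul]
        rw [← hr']
        ring

end MvPolynomial

open Metric

theorem exists_mvPolynomial_near_continuousMap_sphere {ι : Type*} [Fintype ι]
    (g : C(sphere (0 : EuclideanSpace ℝ ι) 1, ℝ)) {ε : ℝ} (hε : 0 < ε) :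
    ∃ P : MvPolynomial ι ℝ, ∀ x : sphere (0 : EuclideanSpace ℝ ι) 1,
      |eval (x : EuclideanSpace ℝ ι).ofLp P - g x| < ε := by
  let coord : ι → C(sphere (0 : EuclideanSpace ℝ ι) 1, ℝ) :=
    fun i => ⟨fun x => (x : EuclideanSpace ℝ ι) i, by fun_prop⟩
  let φ : MvPolynomial ι ℝ →ₐ[ℝ] C(sphere (0 : EuclideanSpace ℝ ι) 1, ℝ) := aeval coord
  have hφ : ∀ P x, φ P x = eval (x : EuclideanSpace ℝ ι).ofLp P := fun P x => by
    have := comp_aeval_apply coord (ContinuousMap.evalAlgHom ℝ ℝ x) P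
    rw [← coe_aeval_eq_eval]
    exact this
  have hsep : φ.range.SeparatesPoints := by
    intro x y hxy
    obtain ⟨i, hi⟩ : ∃ i, (x : EuclideanSpace ℝ ι) i ≠ (y : EuclideanSpace ℝ ι) i := by
      by_contra! h
      exact hxy (Subtype.ext (PiLp.ext h))
    refine ⟨coord i, ⟨coord i, ⟨X i, aeval_X _ _⟩, rfl⟩, hi⟩
  obtain ⟨⟨_, P, rfl⟩, hP⟩ :=
    ContinuousMap.exists_mem_subalgebra_near_continuousMap_of_separatesPoints _ hsep g ε hε
  refine ⟨P, fun x => ?_⟩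
  rw [← hφ, ← Real.norm_eq_abs]
  exact (ContinuousMap.norm_coe_le_norm (φ P - g) x).trans_lt hP

theorem exists_forall_abs_lt_of_odd_sphere {n : ℕ}
    (g : Fin n → C(sphere (0 : EuclideanSpace ℝ (Fin (n + 1))) 1, ℝ))
    (hg : ∀ i x, g i (-x) = -g i x) {ε : ℝ} (hε : 0 < ε) : ∃ x, ∀ i, |g i x| < ε := by
  choose P hP using fun i => exists_mvPolynomial_near_continuousMap_sphere (g i) (half_pos hε)
  choose N hN using fun i => MvPolynomial.exists_eval_eq_norm_pow_mul_sub (P i)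
  obtain ⟨d, hd, hNd⟩ : ∃ d, Odd d ∧ ∀ i, N i ≤ d :=
    ⟨2 * (∑ i, N i) + 1, odd_two_mul_add_one _, fun i => by
      have := Finset.single_le_sum_of_canonicallyOrdered (f := N) (Finset.mem_univ i)
      omega⟩
  choose p hpd hp using fun i => hN i d hd (hNd i)
  obtain ⟨t, ht, c, hc⟩ := MvPolynomial.exists_pow_add_mul_eval_eq_zero hd hpd (2 / ε)
  have ht0 : 0 < t := (by positivity : 0 < 2 / ε).trans ht
  have hpos : 0 < 1 + ∑ i, c i ^ 2 := by positivity
  set r := √(1 + ∑ i, c i ^ 2)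
  have hr0 : 0 < r := Real.sqrt_pos.2 hpos
  have hr2 : r ^ 2 = 1 + ∑ i, c i ^ 2 := Real.sq_sqrt hpos.le
  have hmem : WithLp.toLp 2 (r⁻¹ • (Fin.cons 1 c : Fin (n + 1) → ℝ)) ∈
      sphere (0 : EuclideanSpace ℝ (Fin (n + 1))) 1 := by
    rw [mem_sphere_zero_iff_norm, ← sq_eq_sq₀ (norm_nonneg _) zero_le_one,
      EuclideanSpace.real_norm_sq_eq, Fin.sum_univ_succ]
    simp only [Pi.smul_apply, smul_eq_mul, Fin.cons_zero, Fin.cons_succ, mul_pow]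
    rw [← Finset.mul_sum, ← mul_add, one_pow, ← hr2, ← mul_pow, inv_mul_cancel₀ hr0.ne', one_pow]
  refine ⟨⟨_, hmem⟩, fun i => ?_⟩
  have h1 := hP i ⟨_, hmem⟩
  have h2 := hP i (-⟨_, hmem⟩)
  have h3 := hp i c r hr0 hr2
  rw [hg] at h2
  simp only [coe_neg_sphere, WithLp.ofLp_neg] at h1 h2
  set A := eval (r⁻¹ • (Fin.cons 1 c : Fin (n + 1) → ℝ)) (P i)
  set B := eval (-(r⁻¹ • (Fin.cons 1 c : Fin (n + 1) → ℝ))) (P i)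
  have hci : |c i| ≤ r := by
    refine Real.abs_le_sqrt ?_
    have := Finset.single_le_sum (f := fun i => c i ^ 2) (fun i _ => sq_nonneg _) (Finset.mem_univ i)
    linarith
  have h4 : t * |(A - B) / 2| ≤ 1 := by
    have h5 : r ^ d * (t * |(A - B) / 2|) = |c i| ^ d := by
      rw [← abs_pow, ← abs_of_pos ht0, ← abs_of_pos (pow_pos hr0 d), ← abs_mul, ← abs_mul,
        ← abs_neg]
      congr 1
      linear_combination t / 2 * h3 - hc i
    have h6 : |c i| ^ d ≤ r ^ d := pow_le_pow_left₀ (abs_nonneg _) hci d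
    rw [← h5] at h6
    exact le_of_mul_le_mul_left (by simpa using h6) (pow_pos hr0 d)
  have h7 : |(A - B) / 2| < ε / 2 := by
    rw [gt_iff_lt, div_lt_iff₀ hε] at ht
    nlinarith [abs_nonneg ((A - B) / 2)]
  rw [abs_lt] at h1 h2 h7 ⊢
  constructor <;> linarith [h1.1, h1.2, h2.1, h2.2, h7.1, h7.2]

theorem exists_forall_eq_zero_of_odd_sphere {n : ℕ}
    (g : Fin n → C(sphere (0 : EuclideanSpace ℝ (Fin (n + 1))) 1, ℝ))
    (hg : ∀ i x, g i (-x) = -g i x) : ∃ x, ∀ i, g i x = 0 := by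
  have hne : Nonempty (sphere (0 : EuclideanSpace ℝ (Fin (n + 1))) 1) :=
    (NormedSpace.sphere_nonempty.2 zero_le_one).to_subtype
  have hcont : Continuous fun x => ∑ i, |g i x| := by fun_prop
  obtain ⟨x, -, hx⟩ := isCompact_univ.exists_isMinOn Set.univ_nonempty hcont.continuousOn
  have hx0 : ∑ i, |g i x| = 0 := by
    by_contra hne0
    have hpos : 0 < ∑ i, |g i x| := lt_of_le_of_ne (by positivity) (Ne.symm hne0)
    obtain ⟨y, hy⟩ := exists_forall_abs_lt_of_odd_sphere g hg
      (by positivity : 0 < (∑ i, |g i x|) / (n + 1))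
    have h1 : ∑ i, |g i x| ≤ ∑ i, |g i y| := hx (Set.mem_univ y)
    have h2 : ∑ i, |g i y| ≤ n * ((∑ i, |g i x|) / (n + 1)) := by
      simpa using Finset.sum_le_card_nsmul Finset.univ _ _ fun i _ => (hy i).le
    have h3 : (n + 1 : ℝ) * ((∑ i, |g i x|) / (n + 1)) = ∑ i, |g i x| := by field_simp
    have h4 : 0 < (∑ i, |g i x|) / (n + 1) := by positivity
    linarith
  exact ⟨x, fun i => abs_eq_zero.1
    ((Finset.sum_eq_zero_iff_of_nonneg fun i _ => abs_nonneg _).1 hx0 i (Finset.mem_univ i))⟩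

/-- **Borsuk–Ulam theorem**: every continuous function from the `n`-sphere into
`ℝ^k` with `k ≤ n` maps some pair of antipodal points to the same point. -/
theorem borsuk_ulam (n k : ℕ) (hk : k ≤ n)
    (f : Metric.sphere (0 : EuclideanSpace ℝ (Fin (n + 1))) 1 → EuclideanSpace ℝ (Fin k))
    (hf : Continuous f) :
    ∃ x : Metric.sphere (0 : EuclideanSpace ℝ (Fin (n + 1))) 1, f (-x) = f x := by
  let g : Fin n → C(sphere (0 : EuclideanSpace ℝ (Fin (n + 1))) 1, ℝ) := fun i =>
    if h : (i : ℕ) < k then ⟨fun x => f x ⟨i, h⟩ - f (-x) ⟨i, h⟩, by fun_prop⟩ else 0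
  obtain ⟨x, hx⟩ := exists_forall_eq_zero_of_odd_sphere g fun i x => by
    by_cases h : (i : ℕ) < k <;> simp [g, h]
  refine ⟨x, PiLp.ext fun j => ?_⟩
  have := hx (Fin.castLE hk j)
  simp only [g, Fin.val_castLE, j.2, dif_pos, ContinuousMap.coe_mk] at this
  exact (sub_eq_zero.1 this).symm
end

section
/- Every continuous function f from the closed unit ball B^n in ℝ^n to itself has a fixed point. -/
open MeasureTheory Metric Set

/-- Since `det (1 + t • A)` is a polynomial in `t` of degree at most `dim E`, its value at `t = 1` is
a fixed linear combination of its values at points of `(0, δ)`. -/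
theorem exists_det_one_add_eq_sum {E : Type*} [NormedAddCommGroup E] [NormedSpace ℝ E]
    [FiniteDimensional ℝ E] {δ : ℝ} (hδ : 0 < δ) :
    ∃ (s : Finset ℕ) (t c : ℕ → ℝ), (∀ i ∈ s, t i ∈ Ioo 0 δ) ∧
      ∀ A : E →L[ℝ] E, (1 + A).det = ∑ i ∈ s, c i * (1 + t i • A).det := by
  let b := Module.finBasis ℝ E
  let t : ℕ → ℝ := fun i => δ / (i + 2)
  have ht : Function.Injective t := by
    intro i j hij
    have hi : (i : ℝ) + 2 ≠ 0 := by positivity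
    have hj : (j : ℝ) + 2 ≠ 0 := by positivity
    simp only [t, div_eq_div_iff hi hj] at hij
    have := mul_left_cancel₀ hδ.ne' hij
    exact_mod_cast (add_right_cancel this).symm
  let s := Finset.range (Module.finrank ℝ E + 1)
  refine ⟨s, t, fun i => (Lagrange.basis s t i).eval 1, fun i _ => ⟨by positivity, ?_⟩, ?_⟩
  · exact div_lt_self hδ (by linarith [(Nat.cast_nonneg i : (0 : ℝ) ≤ i)])
  · intro A
    let M := LinearMap.toMatrix b b A
    let p : Polynomial ℝ := ((Polynomial.X : Polynomial ℝ) • M.map Polynomial.C +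
      (1 : Matrix (Fin (Module.finrank ℝ E)) (Fin (Module.finrank ℝ E)) ℝ).map Polynomial.C).det
    have hp (r : ℝ) : p.eval r = (1 + r • A).det := by
      rw [← Polynomial.coe_evalRingHom, RingHom.map_det, ContinuousLinearMap.det,
        ← LinearMap.det_toMatrix b]
      congr 1
      ext i j
      by_cases h : i = j <;> simp [M, h, add_comm, LinearMap.toMatrix_apply] <;> ring
    have hd : p.degree < s.card := by
      refine Polynomial.degree_le_natDegree.trans_lt ?_
      have := Polynomial.natDegree_det_X_add_C_le M 1
      simp only [Fintype.card_fin] at this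
      simp only [s, Finset.card_range]
      exact_mod_cast Nat.lt_succ_of_le this
    have h := congrArg (Polynomial.eval 1) (Lagrange.eq_interpolate (ht.injOn (s := s)) hd)
    simp only [Lagrange.interpolate_apply, Polynomial.eval_finsetSum, Polynomial.eval_mul,
      Polynomial.eval_C, hp, one_smul] at h
    simpa only [mul_comm] using h

/-- A map that vanishes on the unit sphere and is Lipschitz on the unit ball stays Lipschitz when
extended by zero. -/
theorem LipschitzOnWith.indicator_closedBall {E F : Type*} [NormedAddCommGroup E] [NormedSpace ℝ E]
    [NormedAddCommGroup F] {h : E → F} {K : NNReal} (hh : LipschitzOnWith K h (closedBall 0 1))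
    (h0 : ∀ x ∈ sphere (0 : E) 1, h x = 0) :
    LipschitzWith K ((closedBall (0 : E) 1).indicator h) := by
  have key (x y : E) (hx : x ∈ closedBall (0 : E) 1) (hy : y ∉ closedBall (0 : E) 1) :
      ‖h x‖ ≤ K * ‖x - y‖ := by
    rw [mem_closedBall_zero_iff] at hx hy
    obtain ⟨s, hs, hs1⟩ : ∃ s ∈ Icc (0 : ℝ) 1, ‖x + s • (y - x)‖ = 1 := by
      have hc : Continuous fun s : ℝ => ‖x + s • (y - x)‖ := by fun_prop
      refine intermediate_value_Icc zero_le_one hc.continuousOn ⟨by simpa using hx, ?_⟩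
      simpa using (not_le.1 hy).le
    have hz : x + s • (y - x) ∈ sphere (0 : E) 1 := by simpa using hs1
    have := hh.norm_sub_le (mem_closedBall_zero_iff.2 hx) (sphere_subset_closedBall hz)
    rw [h0 _ hz, sub_zero, sub_add_cancel_left, norm_neg, norm_smul, Real.norm_of_nonneg hs.1,
      norm_sub_rev] at this
    refine this.trans (mul_le_mul_of_nonneg_left ?_ K.2)
    exact mul_le_of_le_one_left (norm_nonneg _) hs.2
  refine lipschitzWith_iff_norm_sub_le.2 fun x y => ?_
  by_cases hx : x ∈ closedBall (0 : E) 1 <;> by_cases hy : y ∈ closedBall (0 : E) 1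
  · simpa [indicator_of_mem hx, indicator_of_mem hy] using hh.norm_sub_le hx hy
  · simpa [indicator_of_mem hx, indicator_of_notMem hy] using key x y hx hy
  · simpa [indicator_of_notMem hx, indicator_of_mem hy, norm_sub_rev] using key y x hy hx
  · rw [indicator_of_notMem hx, indicator_of_notMem hy, sub_self, norm_zero]
    positivity

/-- A small Lipschitz perturbation of the identity that fixes the unit sphere pointwise permutes the
unit ball. -/
theorem bijOn_closedBall_id_add_smul {E : Type*} [NormedAddCommGroup E] [NormedSpace ℝ E]
    [CompleteSpace E] {h : E → E} {K : NNReal} (hh : LipschitzOnWith K h (closedBall 0 1))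
    (h0 : ∀ x ∈ sphere (0 : E) 1, h x = 0) {t : ℝ} (ht : |t| * K < 1) :
    BijOn (fun x => x + t • h x) (closedBall 0 1) (closedBall 0 1) := by
  let G : E → E := fun x => x + t • (closedBall (0 : E) 1).indicator h x
  have hL := hh.indicator_closedBall h0
  have hG : ApproximatesLinearOn G (ContinuousLinearEquiv.refl ℝ E : E →L[ℝ] E) univ
      (‖t‖₊ * K) := by
    rw [ApproximatesLinearOn.approximatesLinearOn_iff_lipschitzOnWith, lipschitzOnWith_univ]
    have hsub : G - ((ContinuousLinearEquiv.refl ℝ E : E →L[ℝ] E) : E → E) =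
        (fun x => t • x) ∘ (closedBall (0 : E) 1).indicator h := by
      funext x
      simp [G]
    exact hsub ▸ (lipschitzWith_smul t).comp hL
  have hc : Subsingleton E ∨ ‖t‖₊ * K <
      ‖((ContinuousLinearEquiv.refl ℝ E).symm : E →L[ℝ] E)‖₊⁻¹ := by
    rcases subsingleton_or_nontrivial E with hE | hE
    · exact Or.inl hE
    · right
      have : ‖((ContinuousLinearEquiv.refl ℝ E).symm : E →L[ℝ] E)‖₊ = 1 := by
        ext; exact ContinuousLinearMap.norm_id
      rw [this, inv_one, ← NNReal.coe_lt_coe]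
      simpa using ht
  have hinj : InjOn G univ := hG.injOn hc
  have hsurj := hG.surjective hc
  have hin : EqOn (fun x => x + t • h x) G (closedBall 0 1) := fun x hx => by
    simp [G, indicator_of_mem hx]
  have hout (x : E) (hx : x ∉ closedBall (0 : E) 1) : G x = x := by
    simp [G, indicator_of_notMem hx]
  refine BijOn.congr ⟨fun x hx => ?_, hinj.mono (subset_univ _), fun y hy => ?_⟩ hin.symm
  · by_contra hy
    have : G x = x := hinj (mem_univ _) (mem_univ _) (hout _ hy)
    exact hy (this.symm ▸ hx)
  · obtain ⟨x, rfl⟩ := hsurj y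
    refine ⟨x, ?_, rfl⟩
    by_contra hx
    exact hx (hout x hx ▸ hy)

/-- **No-retraction theorem**, continuously differentiable case: a map from the unit ball to the unit
sphere moves some point of the sphere. -/
theorem exists_ne_of_contDiffAt_of_mapsTo_sphere {E : Type*} [NormedAddCommGroup E]
    [InnerProductSpace ℝ E] [FiniteDimensional ℝ E] {r : E → E}
    (hr : ∀ x ∈ closedBall (0 : E) 1, ContDiffAt ℝ 1 r x)
    (hmaps : MapsTo r (closedBall 0 1) (sphere 0 1)) :
    ∃ x ∈ sphere (0 : E) 1, r x ≠ x := by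
  by_contra! hfix
  borelize E
  let μ : Measure E := Measure.addHaar
  set B : Set E := closedBall 0 1
  have hB : IsCompact B := isCompact_closedBall 0 1
  let A : E → E →L[ℝ] E := fun x => fderiv ℝ r x - 1
  have hA : ContinuousOn A B := fun x hx =>
    (((hr x hx).fderiv_right (m := 0) (by simp)).continuousAt.sub
      continuousAt_const).continuousWithinAt
  have hd (x : E) (hx : x ∈ B) : HasFDerivAt (fun x => r x - x) (A x) x :=
    ((hr x hx).differentiableAt (by simp)).hasFDerivAt.sub (hasFDerivAt_id x)
  obtain ⟨C, hC⟩ := hB.exists_bound_of_continuousOn hA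
  let K : NNReal := C.toNNReal
  have hK (x : E) (hx : x ∈ B) : ‖A x‖ ≤ K := (hC x hx).trans (Real.le_coe_toNNReal C)
  have hL : LipschitzOnWith K (fun x => r x - x) B :=
    (convex_closedBall 0 1).lipschitzOnWith_of_nnnorm_hasFDerivWithin_le
      (fun x hx => (hd x hx).hasFDerivWithinAt) hK
  have h0 (x : E) (hx : x ∈ sphere (0 : E) 1) : r x - x = 0 := by rw [hfix x hx, sub_self]
  have hdet1 : (1 : E →L[ℝ] E).det = 1 := LinearMap.det_id
  obtain ⟨η, hη, hdet⟩ : ∃ η > 0, ∀ T : E →L[ℝ] E, ‖T‖ < η → 0 < (1 + T).det := by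
    have hcont : Continuous fun T : E →L[ℝ] E => (1 + T).det :=
      ContinuousLinearMap.continuous_det.comp (by fun_prop)
    have h1 : (0 : ℝ) < (1 + (0 : E →L[ℝ] E)).det := by
      rw [add_zero, hdet1]
      exact one_pos
    have := hcont.continuousAt.eventually (lt_mem_nhds h1)
    obtain ⟨η, hη, H⟩ := Metric.eventually_nhds_iff.1 this
    exact ⟨η, hη, fun T hT => H (by simpa using hT)⟩
  have hK1 : 0 < (K : ℝ) + 1 := by positivity
  obtain ⟨s, t, c, ht, hsum⟩ := exists_det_one_add_eq_sum (E := E)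
    (δ := min 1 η / (K + 1)) (by positivity)
  have htK {τ : ℝ} (hτ : τ ∈ Ioo 0 (min 1 η / (K + 1))) : |τ| * K < min 1 η := by
    rw [abs_of_pos hτ.1]
    have := (lt_div_iff₀ hK1).1 hτ.2
    nlinarith [hτ.1]
  have hcontdet (τ : ℝ) : ContinuousOn (fun x => (1 + τ • A x).det) B :=
    ContinuousLinearMap.continuous_det.comp_continuousOn (by fun_prop)
  have hvol {τ : ℝ} (hτ : τ ∈ Ioo 0 (min 1 η / (K + 1))) :
      ∫ x in B, (1 + τ • A x).det ∂μ = μ.real B := by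
    have hbij := bijOn_closedBall_id_add_smul hL h0 ((htK hτ).trans_le (min_le_left _ _))
    have := integral_image_eq_integral_abs_det_fderiv_smul μ hB.measurableSet
      (fun x hx => ((hasFDerivAt_id x).add ((hd x hx).const_smul τ)).hasFDerivWithinAt)
      hbij.injOn (fun _ => (1 : ℝ))
    have him : (id + τ • fun x => r x - x) '' B = B := hbij.image_eq
    rw [him] at this
    simp only [integral_const, smul_eq_mul, mul_one, measureReal_restrict_apply_univ] at this
    rw [this]
    refine setIntegral_congr_fun hB.measurableSet fun x hx => ?_
    refine (abs_of_pos (hdet _ ?_)).symm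
    rw [norm_smul, Real.norm_eq_abs]
    exact (mul_le_mul_of_nonneg_left (hK x hx) (abs_nonneg _)).trans_lt
      ((htK hτ).trans_le (min_le_right _ _))
  have hpos : 0 < μ.real B :=
    ENNReal.toReal_pos (measure_closedBall_pos μ 0 one_pos).ne' hB.measure_lt_top.ne
  have hc : ∑ i ∈ s, c i = 1 := by
    have := hsum 0
    simp only [smul_zero, add_zero, hdet1, mul_one] at this
    exact this.symm
  have hone : ∫ x in B, (1 + A x).det ∂μ = μ.real B := by
    rw [integral_congr_ae (Filter.Eventually.of_forall fun x => hsum (A x)),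
      integral_finsetSum _ fun i _ => ((hcontdet (t i)).integrableOn_compact hB).const_mul (c i)]
    simp_rw [integral_const_mul]
    rw [Finset.sum_congr rfl fun i hi => by rw [hvol (ht i hi)], ← Finset.sum_mul, hc, one_mul]
  have hzero : ∫ x in B, (1 + A x).det ∂μ = 0 := by
    rw [setIntegral_congr_set (ae_eq_of_subset_of_measure_ge ball_subset_closedBall
      (Measure.addHaar_unitClosedBall_eq_addHaar_unitBall μ).le measurableSet_ball.nullMeasurableSet
        hB.measure_lt_top.ne).symm]
    refine setIntegral_eq_zero_of_forall_eq_zero fun x hx => ?_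
    have hxB : x ∈ B := ball_subset_closedBall hx
    by_contra hne
    have hr1 (y : E) (hy : y ∈ B) : ‖r y‖ = 1 := by simpa using hmaps hy
    have hdr : HasFDerivAt r (1 + A x) x := by
      simpa [A] using ((hr x hxB).differentiableAt (by simp)).hasFDerivAt
    have hn := hdr.norm_sq
    have hconst : HasFDerivAt (fun y => ‖r y‖ ^ 2) (0 : E →L[ℝ] ℝ) x := by
      refine (hasFDerivAt_const (1 : ℝ) x).congr_of_eventuallyEq ?_
      filter_upwards [isOpen_ball.mem_nhds hx] with y hy
      simp [hr1 y (ball_subset_closedBall hy)]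
    have heq := hn.unique hconst
    have hu : IsUnit (LinearMap.det ((1 + A x : E →L[ℝ] E) : E →ₗ[ℝ] E)) :=
      isUnit_iff_ne_zero.2 hne
    obtain ⟨v, hv⟩ : ∃ v, (1 + A x) v = r x := by
      obtain ⟨v, hv⟩ := (LinearMap.equivOfIsUnitDet hu).surjective (r x)
      exact ⟨v, (LinearMap.equivOfIsUnitDet_apply hu v).symm.trans hv⟩
    have := DFunLike.congr_fun heq v
    change 2 • inner ℝ (r x) ((1 + A x) v) = (0 : ℝ) at this
    rw [hv, real_inner_self_eq_norm_sq, hr1 x hxB] at this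
    norm_num at this
  linarith

/-- Brouwer's fixed-point theorem for continuously differentiable maps. -/
theorem exists_fixedPoint_closedBall_of_contDiff {E : Type*} [NormedAddCommGroup E]
    [InnerProductSpace ℝ E] [FiniteDimensional ℝ E] {g : E → E} (hg : ContDiff ℝ 1 g)
    (hmaps : MapsTo g (closedBall 0 1) (closedBall 0 1)) :
    ∃ x ∈ closedBall (0 : E) 1, g x = x := by
  by_contra! hne
  let u : E → E := fun x => x - g x
  let d : E → ℝ := fun x => inner ℝ x (u x) ^ 2 + (1 - ‖x‖ ^ 2) * ‖u x‖ ^ 2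
  let r : E → E := fun x => x + ((√(d x) - inner ℝ x (u x)) / ‖u x‖ ^ 2) • u x
  have hu : ContDiff ℝ 1 u := contDiff_id.sub hg
  have hupos (x : E) (hx : x ∈ closedBall (0 : E) 1) : 0 < ‖u x‖ ^ 2 := by
    have : u x ≠ 0 := sub_ne_zero.2 (hne x hx).symm
    positivity
  have hinner (x : E) (hx : x ∈ sphere (0 : E) 1) : 0 < inner ℝ x (u x) := by
    have h1 : ‖x‖ = 1 := by simpa using hx
    have h2 : ‖g x‖ ≤ 1 := by simpa using hmaps (sphere_subset_closedBall hx)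
    have h3 := hupos x (sphere_subset_closedBall hx)
    have h4 : ‖g x‖ ^ 2 ≤ 1 := pow_le_one₀ (norm_nonneg _) h2
    simp only [u] at h3 ⊢
    rw [norm_sub_sq_real, h1] at h3
    rw [inner_sub_right, real_inner_self_eq_norm_sq, h1]
    linarith
  have hd (x : E) (hx : x ∈ closedBall (0 : E) 1) : 0 < d x := by
    have hx1 : ‖x‖ ≤ 1 := by simpa using hx
    rcases hx1.lt_or_eq with h | h
    · have : 0 < 1 - ‖x‖ ^ 2 := by nlinarith [norm_nonneg x]
      have := hupos x hx
      positivity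
    · have := hinner x (by simpa using h)
      simp only [d, h]
      nlinarith
  obtain ⟨x, hx, hrx⟩ := exists_ne_of_contDiffAt_of_mapsTo_sphere (r := r)
    (fun x hx => by
      have hi : ContDiffAt ℝ 1 (fun x => (inner ℝ x (u x) : ℝ)) x :=
        (contDiff_id.inner ℝ hu).contDiffAt
      have hdc : ContDiffAt ℝ 1 d x :=
        (hi.pow 2).add (((contDiff_const.sub (contDiff_norm_sq ℝ)).mul (hu.norm_sq ℝ)).contDiffAt)
      exact contDiffAt_id.add ((((hdc.sqrt (hd x hx).ne').sub hi).div (hu.norm_sq ℝ).contDiffAt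
        (hupos x hx).ne').smul hu.contDiffAt))
    (fun x hx => by
      have h1 := Real.sq_sqrt (hd x hx).le
      have h2 : ‖u x‖ ≠ 0 := fun h => (hupos x hx).ne' (by simp [h])
      have h3 : ‖r x‖ ^ 2 = 1 := by
        simp only [r]
        rw [norm_add_sq_real, norm_smul, mul_pow, inner_smul_right, Real.norm_eq_abs, sq_abs]
        field_simp
        simp only [d] at h1 ⊢
        linear_combination h1
      simpa using (pow_eq_one_iff_of_nonneg (norm_nonneg (r x)) two_ne_zero).1 h3)
  have h1 : ‖x‖ = 1 := by simpa using hx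
  refine hrx ?_
  simp [r, d, h1, Real.sqrt_sq (hinner x hx).le]

/-- Continuously differentiable self-maps of the unit ball are uniformly dense among the continuous
ones. -/
theorem exists_contDiff_mapsTo_closedBall_dist_lt {E : Type*} [NormedAddCommGroup E]
    [NormedSpace ℝ E] [FiniteDimensional ℝ E] {f : E → E} (hf : Continuous f)
    (hmaps : ∀ x, f x ∈ closedBall 0 1) {ε : ℝ} (hε : 0 < ε) :
    ∃ g : E → E, ContDiff ℝ 1 g ∧ ∀ x ∈ closedBall (0 : E) 1, g x ∈ closedBall 0 1 ∧
      dist (g x) (f x) < ε := by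
  have hK := (isCompact_closedBall (0 : E) 1).uniformContinuousAt_of_continuousAt f
    (fun x _ => hf.continuousAt) (Metric.dist_mem_uniformity (half_pos (half_pos hε)))
  obtain ⟨δ, hδ, hfδ⟩ := Metric.mem_uniformity_dist.1 hK
  obtain ⟨g, hg, hgf⟩ := hf.exists_contDiff_dist_le_of_forall_mem_ball_dist_le hδ
  have hd (x : E) (hx : x ∈ closedBall (0 : E) 1) : dist (g x) (f x) ≤ ε / 2 / 2 := by
    refine hgf x _ fun y hy => ?_
    rw [dist_comm]
    exact (hfδ (a := x) (b := y) (by rwa [dist_comm]) hx).le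
  have he : 0 < 1 + ε / 2 / 2 := by positivity
  refine ⟨fun x => (1 + ε / 2 / 2)⁻¹ • g x, contDiff_const.smul (hg.of_le (by simp)),
    fun x hx => ?_⟩
  have h1 := hd x hx
  have h2 : ‖f x‖ ≤ 1 := by simpa using hmaps x
  have h3 : ‖g x‖ ≤ 1 + ε / 2 / 2 := by
    rw [dist_eq_norm] at h1
    linarith [norm_le_norm_add_norm_sub' (g x) (f x)]
  constructor
  · rw [mem_closedBall_zero_iff, norm_smul, norm_inv, Real.norm_of_nonneg he.le]
    exact inv_mul_le_one_of_le₀ h3 he.le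
  · have h4 : dist ((1 + ε / 2 / 2)⁻¹ • g x) (g x) ≤ ε / 2 / 2 := by
      have : (1 + ε / 2 / 2)⁻¹ • g x - g x = -((ε / 2 / 2) • (1 + ε / 2 / 2)⁻¹ • g x) := by
        rw [smul_smul, ← sub_eq_zero, sub_neg_eq_add, sub_add_eq_add_sub, ← add_smul, sub_eq_zero]
        convert one_smul ℝ (g x)
        field_simp
      rw [dist_eq_norm, this, norm_neg, norm_smul, Real.norm_of_nonneg (by positivity), norm_smul,
        norm_inv, Real.norm_of_nonneg he.le]
      exact mul_le_of_le_one_right (by positivity) (inv_mul_le_one_of_le₀ h3 he.le)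
    linarith [dist_triangle ((1 + ε / 2 / 2)⁻¹ • g x) (g x) (f x)]

/-- **Brouwer's fixed-point theorem**: every continuous function from the closed
unit ball in `ℝ^n` to itself has a fixed point. -/
theorem brouwer_fixed_point (n : ℕ)
    (f : Metric.closedBall (0 : EuclideanSpace ℝ (Fin n)) 1 →
         Metric.closedBall (0 : EuclideanSpace ℝ (Fin n)) 1)
    (hf : Continuous f) :
    ∃ x : Metric.closedBall (0 : EuclideanSpace ℝ (Fin n)) 1, f x = x := by
  by_contra! hne
  have hcpt : CompactSpace (closedBall (0 : EuclideanSpace ℝ (Fin n)) 1) :=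
    isCompact_iff_compactSpace.1 (isCompact_closedBall _ _)
  have hnonempty : Nonempty (closedBall (0 : EuclideanSpace ℝ (Fin n)) 1) := ⟨⟨0, by simp⟩⟩
  obtain ⟨x₀, hx₀⟩ := (hf.dist continuous_id).exists_forall_le_of_hasCompactSupport
    (HasCompactSupport.of_compactSpace _)
  let ρ : EuclideanSpace ℝ (Fin n) → closedBall (0 : EuclideanSpace ℝ (Fin n)) 1 := fun x =>
    ⟨(max 1 ‖x‖)⁻¹ • x, by
      rw [mem_closedBall_zero_iff, norm_smul, norm_inv, Real.norm_of_nonneg (by positivity)]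
      exact inv_mul_le_one_of_le₀ (le_max_right _ _) (by positivity)⟩
  have hρ : Continuous ρ := by
    refine Continuous.subtype_mk (Continuous.smul
      ((continuous_const.max continuous_norm).inv₀ fun x => ?_) continuous_id) _
    positivity
  obtain ⟨g, hg, hgf⟩ := exists_contDiff_mapsTo_closedBall_dist_lt
    (f := fun x => (f (ρ x) : EuclideanSpace ℝ (Fin n)))
    (continuous_subtype_val.comp (hf.comp hρ)) (fun x => (f (ρ x)).2)
    (dist_pos.2 (hne x₀))
  obtain ⟨x, hx, hgx⟩ := exists_fixedPoint_closedBall_of_contDiff hg fun x hx => (hgf x hx).1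
  have hρx : ρ x = ⟨x, hx⟩ := by
    ext1
    simp [ρ, max_eq_left (mem_closedBall_zero_iff.1 hx)]
  have h1 := (hgf x hx).2
  rw [hgx, hρx, dist_comm] at h1
  exact (hx₀ ⟨x, hx⟩).not_gt h1
end
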